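/- For every bi-hinge (ξ_ij)_{1 ≤ i ≤ p, 1 ≤ j ≤ q} there exists A ∈ GL(n,k) such that χ_ij(A) = ξ_ij for all i, j. (Surjectivity part of Theorem 1.) -/

import Mathlib

namespace Neretin

open scoped BigOperators

variable {k : Type*} [Field k]

/-- Offset of the `i`-th block of the partition `α`. -/
def off {p : ℕ} (α : Fin p → ℕ) (i : Fin p) : ℕ := ∑ i' ∈ Finset.Iio i, α i'

theorem coord_lt {p n : ℕ} {α : Fin p → ℕ} (hα : ∑ i, α i = n) (i : Fin p)
    (t : Fin (α i)) : off α i + (t : ℕ) < n := by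
  have h1 : off α i + α i ≤ n := by
    rw [← hα]
    have h2 : insert i (Finset.Iio i) = Finset.Iic i := Finset.Iio_insert i
    have h3 : off α i + α i = ∑ i' ∈ Finset.Iic i, α i' := by
      rw [← h2, Finset.sum_insert (by simp)]
      unfold off
      omega
    rw [h3]
    exact Finset.sum_le_sum_of_subset (Finset.subset_univ _)
  have h4 := t.isLt
  omega

/-- The coordinate of `k^n` corresponding to the `t`-th coordinate of the `i`-th block. -/
def coord {p n : ℕ} {α : Fin p → ℕ} (hα : ∑ i, α i = n) (i : Fin p) (t : Fin (α i)) : Fin n :=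
  ⟨off α i + (t : ℕ), coord_lt hα i t⟩

/-- Subspace of vectors vanishing at all coordinates satisfying `P`. -/
def vanishOn {ι : Type*} (P : ι → Prop) : Submodule k (ι → k) :=
  ⨅ r ∈ {r : ι | P r}, LinearMap.ker (LinearMap.proj (R := k) (φ := fun _ : ι => k) r)

/-- The linear relation `χ_ij(A) : V_i ⇉ W_j`. -/
def chi {p q n : ℕ} (α : Fin p → ℕ) (β : Fin q → ℕ) (hα : ∑ i, α i = n) (hβ : ∑ j, β j = n)
    (A : Matrix (Fin n) (Fin n) k) (i : Fin p) (j : Fin q) :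
    Submodule k ((Fin (α i) → k) × (Fin (β j) → k)) :=
  Submodule.map
    ((LinearMap.funLeft k k (coord hα i)).prod
      ((LinearMap.funLeft k k (coord hβ j)).comp (Matrix.mulVecLin A)))
    (vanishOn (fun r : Fin n => off α i + α i ≤ (r : ℕ)) ⊓
      Submodule.comap (Matrix.mulVecLin A) (vanishOn fun r : Fin n => (r : ℕ) < off β j))

section Rel

variable {X Y : Type*} [AddCommGroup X] [Module k X] [AddCommGroup Y] [Module k Y]

/-- Kernel of a linear relation. -/
def rker (L : Submodule k (X × Y)) : Submodule k X := Submodule.comap (LinearMap.inl k X Y) L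

/-- Domain of a linear relation. -/
def rdom (L : Submodule k (X × Y)) : Submodule k X := Submodule.map (LinearMap.fst k X Y) L

/-- Image of a linear relation. -/
def rim (L : Submodule k (X × Y)) : Submodule k Y := Submodule.map (LinearMap.snd k X Y) L

/-- Indefiniteness of a linear relation. -/
def rindef (L : Submodule k (X × Y)) : Submodule k Y := Submodule.comap (LinearMap.inr k X Y) L

end Rel

/-- `blockLT α a b`: coordinate `a` lies in a strictly earlier block than `b`. -/
def blockLT {p : ℕ} (α : Fin p → ℕ) (a b : ℕ) : Prop :=
  ∃ i : Fin p, off α i ≤ b ∧ a < off α i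

/-- `sameBlock α a b` : coordinates `a`, `b` lie in the same block. -/
def sameBlock {p : ℕ} (α : Fin p → ℕ) (a b : ℕ) : Prop :=
  ∀ i : Fin p, off α i ≤ a ↔ off α i ≤ b

/-- Block upper triangular matrices (the group `P_+`). -/
def IsPPlus {n p : ℕ} (α : Fin p → ℕ) (g : Matrix (Fin n) (Fin n) k) : Prop :=
  ∀ r s : Fin n, blockLT α (s : ℕ) (r : ℕ) → g r s = 0

/-- Block lower triangular matrices (the group `P_-`). -/
def IsPMinus {n p : ℕ} (α : Fin p → ℕ) (g : Matrix (Fin n) (Fin n) k) : Prop :=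
  ∀ r s : Fin n, blockLT α (r : ℕ) (s : ℕ) → g r s = 0

/-- Block strictly upper triangular matrices (the group `T_+`). -/
def IsTPlus {n p : ℕ} (α : Fin p → ℕ) (g : Matrix (Fin n) (Fin n) k) : Prop :=
  IsPPlus α g ∧ ∀ r s : Fin n, sameBlock α (r : ℕ) (s : ℕ) → g r s = if r = s then 1 else 0

/-- Block strictly lower triangular matrices (the group `T_-`). -/
def IsTMinus {n p : ℕ} (α : Fin p → ℕ) (g : Matrix (Fin n) (Fin n) k) : Prop :=
  IsPMinus α g ∧ ∀ r s : Fin n, sameBlock α (r : ℕ) (s : ℕ) → g r s = if r = s then 1 else 0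

/-- Bi-hinges. -/
def IsBiHinge {p q : ℕ} (α : Fin p → ℕ) (β : Fin q → ℕ)
    (ξ : (i : Fin p) → (j : Fin q) → Submodule k ((Fin (α i) → k) × (Fin (β j) → k))) : Prop :=
  (∀ (i : Fin p) (j j' : Fin q), (j' : ℕ) = (j : ℕ) + 1 → rker (ξ i j) = rdom (ξ i j')) ∧
  (∀ (i i' : Fin p) (j : Fin q), (i' : ℕ) = (i : ℕ) + 1 → rim (ξ i j) = rindef (ξ i' j)) ∧
  (∀ (i : Fin p) (j : Fin q), (i : ℕ) = 0 → rindef (ξ i j) = ⊥) ∧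
  (∀ (i : Fin p) (j : Fin q), (i : ℕ) + 1 = p → rim (ξ i j) = ⊤) ∧
  (∀ (i : Fin p) (j : Fin q), (j : ℕ) + 1 = q → rker (ξ i j) = ⊥) ∧
  (∀ (i : Fin p) (j : Fin q), (j : ℕ) = 0 → rdom (ξ i j) = ⊤)

/-- 0-1 matrices with exactly one unit in each row and each column. -/
def IsPermMatrix {n : ℕ} (M : Matrix (Fin n) (Fin n) k) : Prop :=
  ∃ σ : Equiv.Perm (Fin n), ∀ r s, M r s = if r = σ s then 1 else 0

/-- Offset of the sub-block `V_i^j` inside `V_i`. -/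
def offA {p q : ℕ} (a : Fin p → Fin q → ℕ) (i : Fin p) (j : Fin q) : ℕ :=
  ∑ j' ∈ Finset.Iio j, a i j'

/-- Offset of the sub-block `W_j^i` inside `W_j`. -/
def offB {p q : ℕ} (a : Fin p → Fin q → ℕ) (i : Fin p) (j : Fin q) : ℕ :=
  ∑ i' ∈ Finset.Iio i, a i' j

open Classical in
/-- The standard 0-1 matrix determined by the dimension data `a`. -/
noncomputable def stdMatrix {p q : ℕ} (n : ℕ) (α : Fin p → ℕ) (β : Fin q → ℕ)
    (a : Fin p → Fin q → ℕ) : Matrix (Fin n) (Fin n) k :=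
  Matrix.of fun r s : Fin n =>
    if ∃ (i : Fin p) (j : Fin q) (t : ℕ), t < a i j ∧
        (s : ℕ) = off α i + offA a i j + t ∧ (r : ℕ) = off β j + offB a i j + t
      then (1 : k) else 0

/-- The standard bi-hinge determined by the dimension data `a`. -/
def stdHinge {p q : ℕ} (α : Fin p → ℕ) (β : Fin q → ℕ) (a : Fin p → Fin q → ℕ)
    (i : Fin p) (j : Fin q) : Submodule k ((Fin (α i) → k) × (Fin (β j) → k)) where
  carrier := {z | (∀ u : Fin (α i), (u : ℕ) < offA a i j → z.1 u = 0) ∧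
    (∀ v : Fin (β j), offB a i j + a i j ≤ (v : ℕ) → z.2 v = 0) ∧
    ∀ (u : Fin (α i)) (v : Fin (β j)) (t : ℕ), t < a i j →
      (u : ℕ) = offA a i j + t → (v : ℕ) = offB a i j + t → z.1 u = z.2 v}
  add_mem' := by
    rintro x y ⟨hx1, hx2, hx3⟩ ⟨hy1, hy2, hy3⟩
    refine ⟨fun u hu => ?_, fun v hv => ?_, fun u v t ht hu hv => ?_⟩
    · show x.1 u + y.1 u = 0
      rw [hx1 u hu, hy1 u hu, add_zero]
    · show x.2 v + y.2 v = 0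
      rw [hx2 v hv, hy2 v hv, add_zero]
    · show x.1 u + y.1 u = x.2 v + y.2 v
      rw [hx3 u v t ht hu hv, hy3 u v t ht hu hv]
  zero_mem' := ⟨fun _ _ => rfl, fun _ _ => rfl, fun _ _ _ _ _ _ => rfl⟩
  smul_mem' := by
    rintro c x ⟨hx1, hx2, hx3⟩
    refine ⟨fun u hu => ?_, fun v hv => ?_, fun u v t ht hu hv => ?_⟩
    · show c * x.1 u = 0
      rw [hx1 u hu, mul_zero]
    · show c * x.2 v = 0
      rw [hx2 v hv, mul_zero]
    · show c * x.1 u = c * x.2 v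
      rw [hx3 u v t ht hu hv]

section Selection

variable {X Y : Type*} [AddCommGroup X] [Module k X] [AddCommGroup Y] [Module k Y]

/-- A linear map `T` selecting a value of the relation `L` at each point of its domain, whose range
lies in the image of `L` and meets the indefiniteness of `L` trivially. -/
structure IsSelection (L : Submodule k (X × Y)) (T : X →ₗ[k] Y) : Prop where
  mem : ∀ x ∈ rdom L, (x, T x) ∈ L
  mem_rim : ∀ x, T x ∈ rim L
  eq_zero : ∀ x, T x ∈ rindef L → T x = 0

theorem mem_rdom {L : Submodule k (X × Y)} {x : X} : x ∈ rdom L ↔ ∃ y, (x, y) ∈ L := by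
  simp [rdom]

theorem mem_rim {L : Submodule k (X × Y)} {y : Y} : y ∈ rim L ↔ ∃ x, (x, y) ∈ L := by
  simp [rim]

theorem mem_rker {L : Submodule k (X × Y)} {x : X} : x ∈ rker L ↔ (x, 0) ∈ L := by
  simp [rker]

theorem mem_rindef {L : Submodule k (X × Y)} {y : Y} : y ∈ rindef L ↔ (0, y) ∈ L := by
  simp [rindef]

theorem rindef_le_rim (L : Submodule k (X × Y)) : rindef L ≤ rim L :=
  fun _ hy => mem_rim.2 ⟨0, mem_rindef.1 hy⟩

theorem exists_isSelection (L : Submodule k (X × Y)) : ∃ T : X →ₗ[k] Y, IsSelection L T := by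
  obtain ⟨s, hs⟩ := ((rindef L).mkQ).exists_rightInverse_of_surjective (Submodule.range_mkQ _)
  set P : Y →ₗ[k] Y := s ∘ₗ (rindef L).mkQ with hP
  have hsub (y : Y) : P y - y ∈ rindef L := by
    rw [← Submodule.Quotient.eq]
    exact LinearMap.congr_fun hs ((rindef L).mkQ y)
  have hzero (y : Y) (hy : P y ∈ rindef L) : P y = 0 := by
    have : y ∈ rindef L := by simpa using sub_mem hy (hsub y)
    simp [hP, (Submodule.Quotient.mk_eq_zero _).2 this]
  have hfst : ∀ z : L, LinearMap.fst k X Y z ∈ rdom L := fun z => ⟨z, z.2, rfl⟩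
  obtain ⟨f, hf⟩ := LinearMap.exists_rightInverse_of_surjective
    (((LinearMap.fst k X Y).comp L.subtype).codRestrict (rdom L) hfst) <| by
      rw [LinearMap.range_eq_top]
      rintro ⟨x, z, hz, rfl⟩
      exact ⟨⟨z, hz⟩, rfl⟩
  obtain ⟨g, hg⟩ := LinearMap.exists_extend f
  refine ⟨P ∘ₗ LinearMap.snd k X Y ∘ₗ L.subtype ∘ₗ g, fun x hx => ?_, fun x => ?_,
    fun x hx => hzero _ hx⟩
  · have h1 : ((g x : L) : X × Y).1 = x := by
      have h2 : g x = f ⟨x, hx⟩ := LinearMap.congr_fun hg ⟨x, hx⟩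
      rw [h2]
      exact congrArg Subtype.val (LinearMap.congr_fun hf ⟨x, hx⟩)
    have h3 := add_mem (g x).2 (mem_rindef.1 (hsub (g x : X × Y).2))
    convert h3 using 1
    ext <;> simp [h1]
  · have h1 : ((g x : L) : X × Y).2 ∈ rim L := ⟨_, (g x).2, rfl⟩
    simpa using add_mem (rindef_le_rim L (hsub (g x : X × Y).2)) h1

theorem IsSelection.mem_rker_iff {L : Submodule k (X × Y)} {T : X →ₗ[k] Y} (h : IsSelection L T)
    {x : X} : x ∈ rker L ↔ x ∈ rdom L ∧ T x = 0 := by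
  rw [mem_rker]
  constructor
  · intro hx
    have hd : x ∈ rdom L := mem_rdom.2 ⟨0, hx⟩
    exact ⟨hd, h.eq_zero x (mem_rindef.2 (by simpa using sub_mem (h.mem x hd) hx))⟩
  · rintro ⟨hd, h0⟩
    simpa [h0] using h.mem x hd

theorem IsSelection.mem_iff {L : Submodule k (X × Y)} {T : X →ₗ[k] Y} (h : IsSelection L T)
    {x : X} {y : Y} : (x, y) ∈ L ↔ x ∈ rdom L ∧ y - T x ∈ rindef L := by
  rw [mem_rindef]
  constructor
  · intro hx
    have hd : x ∈ rdom L := mem_rdom.2 ⟨y, hx⟩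
    exact ⟨hd, by simpa using sub_mem hx (h.mem x hd)⟩
  · rintro ⟨hd, h0⟩
    simpa using add_mem (h.mem x hd) h0

end Selection

section Row

variable {q : ℕ} {X : Type*} {W : Fin q → Type*} [AddCommGroup X] [Module k X]
  [∀ j, AddCommGroup (W j)] [∀ j, Module k (W j)]
  {L : (j : Fin q) → Submodule k (X × W j)} {T : (j : Fin q) → X →ₗ[k] W j}

theorem mem_rdom_iff_forall_lt (hT : ∀ j, IsSelection (L j) (T j))
    (hker : ∀ j j' : Fin q, (j' : ℕ) = (j : ℕ) + 1 → rker (L j) = rdom (L j'))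
    (htop : ∀ j : Fin q, (j : ℕ) = 0 → rdom (L j) = ⊤) {x : X} (j : Fin q) :
    x ∈ rdom (L j) ↔ ∀ m < j, T m x = 0 := by
  obtain ⟨j, hj⟩ := j
  induction j with
  | zero => simp [htop ⟨0, hj⟩ rfl, Fin.lt_def]
  | succ j ih =>
    have hj' : j < q := by omega
    rw [← hker ⟨j, hj'⟩ ⟨j + 1, hj⟩ rfl, (hT _).mem_rker_iff, ih hj']
    constructor
    · rintro ⟨h1, h2⟩ m hm
      rcases Nat.lt_succ_iff_lt_or_eq.1 (Fin.lt_def.1 hm) with h | h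
      · exact h1 m h
      · rwa [show m = ⟨j, hj'⟩ from Fin.ext h]
    · intro h
      exact ⟨fun m hm => h m (hm.trans (Nat.lt_succ_self j)), h _ (Nat.lt_succ_self j)⟩

theorem eq_zero_of_forall_selection_eq_zero (hq : 0 < q) (hT : ∀ j, IsSelection (L j) (T j))
    (hker : ∀ j j' : Fin q, (j' : ℕ) = (j : ℕ) + 1 → rker (L j) = rdom (L j'))
    (htop : ∀ j : Fin q, (j : ℕ) = 0 → rdom (L j) = ⊤)
    (hbot : ∀ j : Fin q, (j : ℕ) + 1 = q → rker (L j) = ⊥) {x : X} (hx : ∀ j, T j x = 0) :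
    x = 0 := by
  have h1 : x ∈ rker (L ⟨q - 1, by omega⟩) :=
    (hT _).mem_rker_iff.2 ⟨(mem_rdom_iff_forall_lt hT hker htop _).2 fun m _ => hx m, hx _⟩
  rwa [hbot _ (by simp; omega), Submodule.mem_bot] at h1

end Row

section Column

variable {p : ℕ} {V : Fin p → Type*} {Y : Type*} [∀ i, AddCommGroup (V i)] [∀ i, Module k (V i)]
  [AddCommGroup Y] [Module k Y]
  {L : (i : Fin p) → Submodule k (V i × Y)} {T : (i : Fin p) → V i →ₗ[k] Y}

theorem rim_le_rindef_of_lt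
    (him : ∀ i i' : Fin p, (i' : ℕ) = (i : ℕ) + 1 → rim (L i) = rindef (L i'))
    {i i' : Fin p} (h : i < i') : rim (L i) ≤ rindef (L i') := by
  obtain ⟨i', hi'⟩ := i'
  induction i' with
  | zero => exact absurd h (Nat.not_lt_zero _)
  | succ m ih =>
    have hm : m < p := by omega
    rw [← him ⟨m, hm⟩ ⟨m + 1, hi'⟩ rfl]
    rcases Nat.lt_succ_iff_lt_or_eq.1 (Fin.lt_def.1 h) with h | h
    · exact (ih hm h).trans (rindef_le_rim _)
    · rw [show i = ⟨m, hm⟩ from Fin.ext h]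

theorem sum_lt_mem_rindef (hT : ∀ i, IsSelection (L i) (T i))
    (him : ∀ i i' : Fin p, (i' : ℕ) = (i : ℕ) + 1 → rim (L i) = rindef (L i'))
    (x : ∀ i, V i) (i : Fin p) : ∑ l ∈ Finset.Iio i, T l (x l) ∈ rindef (L i) :=
  sum_mem fun _ hl => rim_le_rindef_of_lt him (Finset.mem_Iio.1 hl) ((hT _).mem_rim _)

theorem sum_eq_sum_lt_add {M : Type*} [AddCommMonoid M] {y : Fin p → M} {i : Fin p}
    (hy : ∀ l, i < l → y l = 0) : ∑ l, y l = ∑ l ∈ Finset.Iio i, y l + y i := by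
  rw [add_comm, ← Finset.sum_insert (f := y) (by simp), Finset.Iio_insert]
  exact (Finset.sum_subset (Finset.subset_univ _) fun l _ hl => hy l (by simpa using hl)).symm

theorem selection_eq_zero_of_sum_eq_zero (hT : ∀ i, IsSelection (L i) (T i))
    (him : ∀ i i' : Fin p, (i' : ℕ) = (i : ℕ) + 1 → rim (L i) = rindef (L i'))
    {x : ∀ i, V i} (hx : ∑ l, T l (x l) = 0) (i : Fin p) : T i (x i) = 0 := by
  induction i using WellFoundedGT.induction with
  | ind i ih =>
    rw [sum_eq_sum_lt_add ih] at hx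
    refine (hT i).eq_zero _ ?_
    rw [eq_neg_of_add_eq_zero_right hx]
    exact neg_mem (sum_lt_mem_rindef hT him x i)

theorem exists_sum_lt_eq (hT : ∀ i, IsSelection (L i) (T i))
    (him : ∀ i i' : Fin p, (i' : ℕ) = (i : ℕ) + 1 → rim (L i) = rindef (L i'))
    (hbot : ∀ i : Fin p, (i : ℕ) = 0 → rindef (L i) = ⊥) (i : Fin p) {w : Y}
    (hw : w ∈ rindef (L i)) :
    ∃ x : ∀ l, V l, (∀ l, x l ∈ rdom (L l)) ∧ ∑ l ∈ Finset.Iio i, T l (x l) = w := by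
  obtain ⟨i, hi⟩ := i
  induction i generalizing w with
  | zero =>
    rw [hbot _ rfl, Submodule.mem_bot] at hw
    refine ⟨0, fun l => zero_mem _, ?_⟩
    simp [hw]
  | succ i ih =>
    have hi' : i < p := by omega
    rw [← him ⟨i, hi'⟩ ⟨i + 1, hi⟩ rfl, mem_rim] at hw
    obtain ⟨v, hv⟩ := hw
    obtain ⟨hd, hr⟩ := (hT _).mem_iff.1 hv
    obtain ⟨x, hx, hsum⟩ := ih hi' hr
    refine ⟨Function.update x ⟨i, hi'⟩ v, fun l => ?_, ?_⟩
    · rcases eq_or_ne l ⟨i, hi'⟩ with rfl | h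
      · simpa using hd
      · simpa [h] using hx l
    · have hI : Finset.Iio (⟨i + 1, hi⟩ : Fin p) = insert ⟨i, hi'⟩ (Finset.Iio ⟨i, hi'⟩) := by
        ext l
        simp only [Finset.mem_Iio, Finset.mem_insert, Fin.lt_def, Fin.ext_iff]
        omega
      rw [hI, Finset.sum_insert (by simp), Function.update_self,
        Finset.sum_congr rfl fun l hl => by
          rw [Function.update_of_ne (Finset.mem_Iio.1 hl).ne], hsum, add_sub_cancel]

end Column

section Blocks

variable {p n : ℕ} {α : Fin p → ℕ}

theorem off_add_le {i i' : Fin p} (h : i < i') : off α i + α i ≤ off α i' := by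
  unfold off
  rw [add_comm, ← Finset.sum_insert (f := α) (by simp), Finset.Iio_insert]
  exact Finset.sum_le_sum_of_subset fun l hl => by simp at hl ⊢; omega

theorem coord_bijective (hα : ∑ i, α i = n) :
    Function.Bijective fun s : (i : Fin p) × Fin (α i) => coord hα s.1 s.2 := by
  rw [Fintype.bijective_iff_injective_and_card]
  refine ⟨?_, by simp [hα]⟩
  rintro ⟨i, t⟩ ⟨i', t'⟩ h
  have h : off α i + t = off α i' + t' := congrArg Fin.val h
  have ht := t.isLt
  have ht' := t'.isLt
  rcases lt_trichotomy i i' with hlt | rfl | hlt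
  · have := off_add_le (α := α) hlt
    omega
  · obtain rfl : t = t' := Fin.ext (by omega)
    rfl
  · have := off_add_le (α := α) hlt
    omega

/-- The decomposition of `k^n` into blocks. -/
noncomputable def blockEquiv (k : Type*) [Field k] (hα : ∑ i, α i = n) :
    (Fin n → k) ≃ₗ[k] ((i : Fin p) → Fin (α i) → k) :=
  (LinearEquiv.funCongrLeft k k (Equiv.ofBijective _ (coord_bijective hα))).trans
    (LinearEquiv.piCurry k fun _ _ => k)

theorem mem_vanishOn {ι : Type*} {P : ι → Prop} {x : ι → k} :
    x ∈ vanishOn (k := k) P ↔ ∀ r, P r → x r = 0 := by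
  simp [vanishOn]

theorem mem_vanishOn_ge_iff (hα : ∑ i, α i = n) {x : Fin n → k} {i : Fin p} :
    x ∈ vanishOn (k := k) (fun r : Fin n => off α i + α i ≤ (r : ℕ)) ↔
      ∀ l, i < l → blockEquiv k hα x l = 0 := by
  rw [mem_vanishOn]
  constructor
  · intro h l hl
    ext t
    exact h (coord hα l t) ((off_add_le hl).trans (Nat.le_add_right _ _))
  · intro h r hr
    obtain ⟨⟨l, t⟩, rfl⟩ := (coord_bijective hα).2 r
    refine congrFun (h l (lt_of_not_ge fun hl => ?_)) t
    have hr : off α i + α i ≤ off α l + t := hr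
    have ht := t.isLt
    rcases hl.lt_or_eq with hl | rfl
    · have := off_add_le (α := α) hl
      omega
    · omega

theorem mem_vanishOn_lt_iff (hα : ∑ i, α i = n) {x : Fin n → k} {i : Fin p} :
    x ∈ vanishOn (k := k) (fun r : Fin n => (r : ℕ) < off α i) ↔
      ∀ l < i, blockEquiv k hα x l = 0 := by
  rw [mem_vanishOn]
  constructor
  · intro h l hl
    ext t
    have := off_add_le (α := α) hl
    exact h (coord hα l t) (show off α l + t < off α i by have := t.isLt; omega)
  · intro h r hr
    obtain ⟨⟨l, t⟩, rfl⟩ := (coord_bijective hα).2 r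
    refine congrFun (h l (lt_of_not_ge fun hl => ?_)) t
    have hr : off α l + t < off α i := hr
    rcases hl.lt_or_eq with hl | rfl
    · have := off_add_le (α := α) hl
      omega
    · omega

variable {q : ℕ} {β : Fin q → ℕ}

theorem mem_chi_iff (hα : ∑ i, α i = n) (hβ : ∑ j, β j = n) {A : Matrix (Fin n) (Fin n) k}
    {T : (i : Fin p) → (j : Fin q) → (Fin (α i) → k) →ₗ[k] (Fin (β j) → k)}
    (hA : ∀ x j, blockEquiv k hβ (A.mulVecLin x) j = ∑ l, T l j (blockEquiv k hα x l))
    {i : Fin p} {j : Fin q} {u : Fin (α i) → k} {v : Fin (β j) → k} :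
    (u, v) ∈ chi α β hα hβ A i j ↔ ∃ x : (l : Fin p) → Fin (α l) → k,
      (∀ l, i < l → x l = 0) ∧ (∀ m < j, ∑ l, T l m (x l) = 0) ∧ x i = u ∧
        ∑ l, T l j (x l) = v := by
  rw [(blockEquiv k hα).surjective.exists]
  simp only [chi, Submodule.mem_map, Submodule.mem_inf, Submodule.mem_comap,
    mem_vanishOn_ge_iff hα, mem_vanishOn_lt_iff hβ, hA, and_assoc]
  refine exists_congr fun x => and_congr_right fun _ => and_congr_right fun _ => ?_
  rw [← hA]
  exact Prod.mk_inj

end Blocks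

theorem statement6 (p q n : ℕ) (hp : 0 < p) (hq : 0 < q)
    (α : Fin p → ℕ) (β : Fin q → ℕ)
    (hαpos : ∀ i, 0 < α i) (hβpos : ∀ j, 0 < β j)
    (hα : ∑ i, α i = n) (hβ : ∑ j, β j = n)
    (ξ : (i : Fin p) → (j : Fin q) → Submodule k ((Fin (α i) → k) × (Fin (β j) → k)))
    (hξ : IsBiHinge α β ξ) :
    ∃ A : GL (Fin n) k, ∀ (i : Fin p) (j : Fin q), chi α β hα hβ A.val i j = ξ i j := by
  obtain ⟨hker, him, hbot, -, hkbot, hdtop⟩ := hξ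
  choose T hT using fun i j => exists_isSelection (ξ i j)
  let F : (Fin n → k) →ₗ[k] (Fin n → k) :=
    (blockEquiv k hβ).symm.toLinearMap ∘ₗ
      LinearMap.pi (fun j => ∑ l, T l j ∘ₗ LinearMap.proj l) ∘ₗ (blockEquiv k hα).toLinearMap
  have hF : ∀ x j, blockEquiv k hβ (F x) j = ∑ l, T l j (blockEquiv k hα x l) := by
    intro x j
    simp [F]
  have hinj : Function.Injective F := by
    rw [injective_iff_map_eq_zero]
    intro x hx
    rw [← (blockEquiv k hα).map_eq_zero_iff]
    ext1 i
    refine eq_zero_of_forall_selection_eq_zero hq (hT i) (hker i) (hdtop i) (hkbot i) fun j => ?_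
    refine selection_eq_zero_of_sum_eq_zero (fun i => hT i j) (fun i i' => him i i' j) ?_ i
    rw [← hF, hx, map_zero, Pi.zero_apply]
  have hA : (LinearMap.toMatrix' F).mulVecLin = F := by
    rw [← Matrix.toLin'_apply', Matrix.toLin'_toMatrix']
  have hunit : IsUnit (LinearMap.toMatrix' F) := by
    rw [← Matrix.mulVec_injective_iff_isUnit, ← Matrix.coe_mulVecLin, hA]
    exact hinj
  refine ⟨hunit.unit, fun i j => ?_⟩
  ext ⟨u, v⟩
  rw [IsUnit.unit_spec, mem_chi_iff hα hβ (T := T) (by rwa [hA]), (hT i j).mem_iff]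
  have hdom (l : Fin p) {x : Fin (α l) → k} (j : Fin q) :=
    mem_rdom_iff_forall_lt (hT l) (hker l) (hdtop l) (x := x) j
  constructor
  · rintro ⟨x, hgt, hlt, rfl, rfl⟩
    refine ⟨(hdom i j).2 fun m hm => ?_, ?_⟩
    · exact selection_eq_zero_of_sum_eq_zero (fun i => hT i m) (fun i i' => him i i' m)
        (hlt m hm) i
    · rw [sum_eq_sum_lt_add (i := i) fun l hl => by rw [hgt l hl, map_zero], add_sub_cancel_right]
      exact sum_lt_mem_rindef (fun i => hT i j) (fun i i' => him i i' j) x i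
  · rintro ⟨hu, hv⟩
    obtain ⟨x, hx, hsum⟩ := exists_sum_lt_eq (fun i => hT i j) (fun i i' => him i i' j)
      (fun i => hbot i j) i hv
    let x' : (l : Fin p) → Fin (α l) → k :=
      Function.update (fun l => if l < i then x l else 0) i u
    have hi : x' i = u := Function.update_self ..
    have hlt : ∀ l < i, x' l = x l := fun l hl => by simp [x', hl.ne, hl]
    have hgt : ∀ l, i < l → x' l = 0 := fun l hl => by simp [x', hl.ne', hl.not_gt]
    have hdom' : ∀ l, x' l ∈ rdom (ξ l j) := by
      intro l
      rcases lt_trichotomy l i with h | rfl | h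
      · rw [hlt l h]
        exact hx l
      · rwa [hi]
      · rw [hgt l h]
        exact zero_mem _
    refine ⟨x', hgt, fun m hm => Finset.sum_eq_zero fun l _ => (hdom l j).1 (hdom' l) m hm,
      hi, ?_⟩
    rw [sum_eq_sum_lt_add (i := i) fun l hl => by rw [hgt l hl, map_zero], hi,
      Finset.sum_congr rfl fun l hl => by rw [hlt l (Finset.mem_Iio.1 hl)], hsum,
      sub_add_cancel]

end Neretin
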